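/- Define a_0 = 0 and let (a_n)_{n≥1} be the increasing enumeration of the positive integers whose odd part is congruent to 1 modulo 4. Then for every n ≥ 0, a_{n+1} - a_n = 2 holds if and only if there exists an integer r ≥ 0 such that n = 8r + (1 + s_{16r+2})/2; in that case a_n = 16r + 2, and such an r is unique, namely r = ⌊a_n/16⌋. -/

import Mathlib

/-- The sequence `j`: `j 0 = 0`, `j (2k) = j k`, `j (2k+1) = (-1)^k`. -/
def j : ℕ → ℤ
  | 0 => 0
  | (n+1) =>
      if (n+1) % 2 = 1 then (-1 : ℤ) ^ ((n+1)/2)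
      else j ((n+1)/2)
decreasing_by omega

/-- `s n = 1 + ∑_{k=0}^{n} j k`. -/
def s (n : ℕ) : ℤ := 1 + ∑ k ∈ Finset.range (n+1), j k

/-- The odd part (largest odd divisor) of a positive integer. -/
def oddPart (m : ℕ) : ℕ := m / 2 ^ (m.factorization 2)

lemma j_two_mul (k : ℕ) : j (2 * k) = j k := by
  rcases k with _ | k
  · rfl
  · rw [show 2 * (k + 1) = (2 * k + 1) + 1 by ring, j, if_neg (by omega)]
    congr 1
    omega

lemma j_two_mul_add_one (k : ℕ) : j (2 * k + 1) = (-1) ^ k := by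
  rw [j, if_pos (by omega)]
  congr 1
  omega

lemma j_four_mul_add_one (k : ℕ) : j (4 * k + 1) = 1 := by
  rw [show 4 * k + 1 = 2 * (2 * k) + 1 by ring, j_two_mul_add_one]
  simp

lemma j_four_mul_add_three (k : ℕ) : j (4 * k + 3) = -1 := by
  rw [show 4 * k + 3 = 2 * (2 * k + 1) + 1 by ring, j_two_mul_add_one]
  simp [pow_succ]

lemma oddPart_two_mul {k : ℕ} (hk : 0 < k) : oddPart (2 * k) = oddPart k := by
  have h : (2 * k).factorization 2 = k.factorization 2 + 1 := by
    rw [Nat.factorization_mul (by norm_num) hk.ne', Finsupp.add_apply,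
      Nat.prime_two.factorization_self, add_comm]
  rw [oddPart, oddPart, h, pow_succ', Nat.mul_div_mul_left _ _ (by norm_num)]

lemma oddPart_two_mul_add_one (k : ℕ) : oddPart (2 * k + 1) = 2 * k + 1 := by
  rw [oddPart, Nat.factorization_eq_zero_of_not_dvd (by omega)]
  simp

/-- For positive `m`, `j m` is `1` or `-1` according to the class modulo `4` of the odd part. -/
lemma j_eq_ite (m : ℕ) (hm : 0 < m) : j m = if oddPart m % 4 = 1 then 1 else -1 := by
  induction m using Nat.strong_induction_on with
  | _ m ih =>
    obtain ⟨k, rfl | rfl⟩ := Nat.even_or_odd' m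
    · rw [j_two_mul, oddPart_two_mul (by omega)]
      exact ih k (by omega) (by omega)
    · rw [oddPart_two_mul_add_one]
      obtain ⟨l, rfl | rfl⟩ := Nat.even_or_odd' k
      · rw [show 2 * (2 * l) + 1 = 4 * l + 1 by ring, j_four_mul_add_one, if_pos (by omega)]
      · rw [show 2 * (2 * l + 1) + 1 = 4 * l + 3 by ring, j_four_mul_add_three,
          if_neg (by omega)]

lemma oddPart_mod_four_eq_one_iff {m : ℕ} (hm : 0 < m) : oddPart m % 4 = 1 ↔ j m = 1 := by
  rw [j_eq_ite m hm]
  split_ifs <;> simp_all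

lemma j_zero : j 0 = 0 := by rw [j]

lemma two_mul_count_j_eq_one (m : ℕ) :
    (2 * Nat.count (fun k => j k = 1) (m + 1) : ℤ) = m + s m - 1 := by
  induction m with
  | zero => simp [Nat.count_succ, s, j_zero]
  | succ m ih =>
    have hs : s (m + 1) = s m + j (m + 1) := by
      rw [s, s, Finset.sum_range_succ _ (m + 1), add_assoc]
    rw [Nat.count_succ, hs]
    have hj := j_eq_ite (m + 1) (by omega)
    split_ifs at hj <;> simp [hj] <;> linarith

/-- The integers `m` at which `j` takes the values `1, -1, 1` on `m, m + 1, m + 2`. -/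
lemma j_one_neg_one_one_iff (m : ℕ) :
    (j m = 1 ∧ j (m + 1) ≠ 1 ∧ j (m + 2) = 1) ↔ m % 16 = 2 := by
  constructor
  · rintro ⟨h₀, h₁, h₂⟩
    have h : ∀ k, k % 4 = 1 → j k = 1 := fun k hk => by
      rw [show k = 4 * (k / 4) + 1 by omega, j_four_mul_add_one]
    have h' : ∀ k, k % 4 = 3 → j k ≠ 1 := fun k hk => by
      rw [show k = 4 * (k / 4) + 3 by omega, j_four_mul_add_three]
      norm_num
    have a₁ : m % 4 ≠ 1 := fun e => h' _ (by omega) h₂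
    have a₃ : m % 4 ≠ 3 := fun e => h' _ e h₀
    have a₀ : m % 4 ≠ 0 := fun e => h₁ (h _ (by omega))
    rw [show m = 2 * (m / 2) by omega, j_two_mul] at h₀
    rw [show m + 2 = 2 * (2 * ((m + 2) / 4)) by omega, j_two_mul, j_two_mul] at h₂
    have b : m / 2 % 4 ≠ 3 := fun e => h' _ e h₀
    have c : (m + 2) / 4 % 4 ≠ 3 := fun e => h' _ e h₂
    omega
  · intro h
    obtain ⟨r, rfl⟩ : ∃ r, m = 16 * r + 2 := ⟨m / 16, by omega⟩
    refine ⟨?_, ?_, ?_⟩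
    · rw [show 16 * r + 2 = 2 * (4 * (2 * r) + 1) by ring, j_two_mul, j_four_mul_add_one]
    · rw [show 16 * r + 2 + 1 = 4 * (4 * r) + 3 by ring, j_four_mul_add_three]
      norm_num
    · rw [show 16 * r + 2 + 2 = 2 * (2 * (4 * r + 1)) by ring, j_two_mul, j_two_mul,
        j_four_mul_add_one]

/-- If `0 = a 0 < a 1 < ⋯` and `a 1, a 2, …` enumerate `p`, then `p` holds `n` times up to `a n`. -/
lemma count_succ_of_strictMono {p : ℕ → Prop} [DecidablePred p] (hp0 : ¬ p 0) {a : ℕ → ℕ}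
    (ha : StrictMono a) (ha0 : a 0 = 0) (hp : ∀ m, 0 < m → ((∃ n, a n = m) ↔ p m)) (n : ℕ) :
    Nat.count p (a n + 1) = n := by
  have h : (Finset.range (a n + 1)).filter p = (Finset.Icc 1 n).image a := by
    ext m
    simp only [Finset.mem_filter, Finset.mem_range, Finset.mem_image, Finset.mem_Icc]
    constructor
    · rintro ⟨hm, hpm⟩
      have hm0 : 0 < m := Nat.pos_of_ne_zero fun e => hp0 (e ▸ hpm)
      obtain ⟨k, rfl⟩ := (hp m hm0).2 hpm
      refine ⟨k, ⟨Nat.pos_of_ne_zero fun e => ?_, ha.le_iff_le.1 (by omega)⟩, rfl⟩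
      subst e
      omega
    · rintro ⟨k, ⟨hk1, hkn⟩, rfl⟩
      have hpos : a 0 < a k := ha hk1
      have hle := ha.monotone hkn
      exact ⟨by omega, (hp _ (by omega)).1 ⟨k, rfl⟩⟩
  rw [Nat.count_eq_card_filter_range, h, Finset.card_image_of_injective _ ha.injective]
  simp

theorem stmt5 (a : ℕ → ℕ) (ha : StrictMono a) (ha0 : a 0 = 0)
    (hrange : ∀ m : ℕ, 0 < m →
      ((∃ n, a n = m) ↔ oddPart m % 4 = 1)) :
    ∀ n : ℕ,
      ((a (n+1) - a n = 2) ↔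
        ∃ r : ℕ, (n : ℤ) = 8 * r + (1 + s (16 * r + 2)) / 2) ∧
      (∀ r : ℕ, (n : ℤ) = 8 * r + (1 + s (16 * r + 2)) / 2 →
        a n = 16 * r + 2 ∧ r = a n / 16) := by
  have hj : ∀ m, 0 < m → ((∃ n, a n = m) ↔ j m = 1) := fun m hm =>
    (hrange m hm).trans (oddPart_mod_four_eq_one_iff hm)
  have hcount := count_succ_of_strictMono (p := fun k => j k = 1) (by simp [j_zero]) ha ha0 hj
  have hindex : ∀ n r : ℕ, (n : ℤ) = 8 * r + (1 + s (16 * r + 2)) / 2 ↔ a n = 16 * r + 2 := by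
    intro n r
    have hc := two_mul_count_j_eq_one (16 * r + 2)
    obtain ⟨k, hk⟩ := (hj (16 * r + 2) (by omega)).2
      ((j_one_neg_one_one_iff (16 * r + 2)).2 (by omega)).1
    have hck := hcount k
    rw [hk] at hck
    rw [hck] at hc
    push_cast at hc
    have hnk : a n = 16 * r + 2 ↔ n = k := by rw [← hk, ha.injective.eq_iff]
    rw [hnk]
    omega
  intro n
  refine ⟨?_, fun r hr => ?_⟩
  · simp only [hindex]
    have hlt : a n < a (n + 1) := ha n.lt_succ_self
    have hgap : ∀ m, a n < m → m < a (n + 1) → j m ≠ 1 := by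
      intro m h₁ h₂ hm
      obtain ⟨k, rfl⟩ := (hj m (by omega)).2 hm
      have := ha.lt_iff_lt.1 h₁
      have := ha.lt_iff_lt.1 h₂
      omega
    constructor
    · intro h
      have h₁ := hgap (a n + 1) (by omega) (by omega)
      have hpos : 0 < a n := by
        refine Nat.pos_of_ne_zero fun e => h₁ ?_
        rw [e]
        exact j_four_mul_add_one 0
      have := (j_one_neg_one_one_iff (a n)).1 ⟨(hj _ hpos).1 ⟨n, rfl⟩, h₁,
        (hj _ (by omega)).1 ⟨n + 1, by omega⟩⟩
      exact ⟨a n / 16, by omega⟩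
    · rintro ⟨r, hr⟩
      obtain ⟨-, h₁, h₂⟩ := (j_one_neg_one_one_iff (a n)).2 (by omega)
      have hle : ¬ a n + 2 < a (n + 1) := fun h => hgap _ (by omega) h h₂
      have hne : a (n + 1) ≠ a n + 1 := fun h =>
        h₁ ((hj _ (by omega)).1 ⟨n + 1, h⟩)
      omega
  · have := (hindex n r).1 hr
    omega
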